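/- There exists a universal constant C' > 0 such that the following holds. Let N, q, h, T, L, M, U be positive integers, let X ∈ ℝ^{N×q}, and let Ā ∈ ℝ^{N×N} be a real symmetric matrix with eigenvalues λ_1, …, λ_N. Let σ : ℝ → ℝ be 1-Lipschitz with σ(0) = 0 and |σ(t)| ≤ R for all t ∈ ℝ. Fix nonnegative reals B^{(0)}, …, B^{(T+1)} and nonnegative reals θ_0, θ_1, …, θ_L. For weight matrices W^{(0)} ∈ ℝ^{q×h}, W^{(1)}, …, W^{(T)} ∈ ℝ^{h×h}, W^{(T+1)} ∈ ℝ^{h×1} such that every column of W^{(l)} has ℓ1-norm at most B^{(l)} for l = 0, …, T+1, set X_T = σ(σ(⋯σ(X W^{(0)}) W^{(1)} ⋯) W^{(T-1)}) (σ applied entrywise, T layers) and f = (θ_0 X_T + Σ_{k=1}^{L} θ_k Ā^k X_T (W^{(T)})^k) W^{(T+1)} ∈ ℝ^N. Let ε be a transductive Rademacher vector with parameter p₀ = MU/(M+U)². Then E_ε[ sup over all admissible weight tuples of |⟨ε, f⟩| ] ≤ C' B^{(T+1)} [ 2^T (∏_{l=0}^{T-1} B^{(l)}) √(2MU/(M+U)²)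 (θ_0 + Σ_{k=1}^{L} (B^{(T)})^k θ_k Σ_{j=1}^N |λ_j|^k) ‖X‖_F + (Σ_{k=1}^{L} (B^{(T)})^k θ_k Σ_{j=1}^N |λ_j|^k) √N R ]. -/

import Mathlib

open Finset

/-- Expectation with respect to a transductive Rademacher vector
`ε ∈ ℝ^N` with i.i.d. coordinates: `P(ε_i = 1) = P(ε_i = -1) = p`,
`P(ε_i = 0) = 1 - 2p`. -/
noncomputable def tExp (N : ℕ) (p : ℝ) (f : (Fin N → ℝ) → ℝ) : ℝ :=
  ∑ s : Fin N → Fin 3,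
    (∏ i, (![p, p, 1 - 2 * p] : Fin 3 → ℝ) (s i)) *
      f (fun i => (![(1 : ℝ), -1, 0]) (s i))

/-- Frobenius norm of a real matrix. -/
noncomputable def frob {m n : ℕ} (X : Matrix (Fin m) (Fin n) ℝ) : ℝ :=
  Real.sqrt (∑ i, ∑ j, (X i j) ^ 2)

/-- `mlp σ X W0 Ws t` is the output of a `(t+1)`-layer MLP with entrywise
activation `σ`: layer `0` is `σ(X W0)`, layer `k+1` multiplies by `Ws k`. -/
noncomputable def mlp {N q h : ℕ} (σ : ℝ → ℝ) (X : Matrix (Fin N) (Fin q) ℝ)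
    (W0 : Matrix (Fin q) (Fin h) ℝ) (Ws : ℕ → Matrix (Fin h) (Fin h) ℝ) :
    ℕ → Matrix (Fin N) (Fin h) ℝ
  | 0 => Matrix.of fun i j => σ ((X * W0) i j)
  | (k + 1) => Matrix.of fun i j => σ ((mlp σ X W0 Ws k * Ws k) i j)

open scoped Matrix

/-- The values taken by a transductive Rademacher vector. -/
def signVec {N : ℕ} (s : Fin N → Fin 3) : Fin N → ℝ :=
  fun i => (![(1 : ℝ), -1, 0]) (s i)

lemma tExp_add (N : ℕ) (p : ℝ) (f g : (Fin N → ℝ) → ℝ) :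
    tExp N p (fun ε => f ε + g ε) = tExp N p f + tExp N p g := by
  simp only [tExp, mul_add, Finset.sum_add_distrib]

lemma tExp_const_mul (N : ℕ) (p a : ℝ) (f : (Fin N → ℝ) → ℝ) :
    tExp N p (fun ε => a * f ε) = a * tExp N p f := by
  simp only [tExp, Finset.mul_sum]
  exact Finset.sum_congr rfl fun s _ => by ring

lemma tExp_sum {ι : Type*} (N : ℕ) (p : ℝ) (t : Finset ι) (f : ι → (Fin N → ℝ) → ℝ) :
    tExp N p (fun ε => ∑ i ∈ t, f i ε) = ∑ i ∈ t, tExp N p (f i) := by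
  simp only [tExp, Finset.mul_sum]
  exact Finset.sum_comm

lemma tExp_zero (p : ℝ) (f : (Fin 0 → ℝ) → ℝ) : tExp 0 p f = f 0 := by
  simp only [tExp, Finset.univ_unique, Finset.sum_singleton, Finset.univ_eq_empty,
    Finset.prod_empty, one_mul]
  exact congrArg f (Subsingleton.elim _ _)

lemma tExp_succ (N : ℕ) (p : ℝ) (f : (Fin (N + 1) → ℝ) → ℝ) :
    tExp (N + 1) p f = p * tExp N p (fun ε => f (Fin.cons 1 ε))
      + p * tExp N p (fun ε => f (Fin.cons (-1) ε))
      + (1 - 2 * p) * tExp N p (fun ε => f (Fin.cons 0 ε)) := by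
  have hcons : ∀ (a : Fin 3) (s : Fin N → Fin 3),
      (fun i => (![(1 : ℝ), -1, 0]) ((Fin.cons a s : Fin (N + 1) → Fin 3) i)) =
        Fin.cons ((![(1 : ℝ), -1, 0]) a) (fun i => (![(1 : ℝ), -1, 0]) (s i)) := by
    intro a s
    funext i
    refine Fin.cases ?_ (fun i => ?_) i <;> simp
  unfold tExp
  rw [← (Fin.consEquiv (fun _ => Fin 3)).sum_comp, Fintype.sum_prod_type]
  simp only [Fin.consEquiv_apply, hcons, Fin.prod_univ_succ, Fin.cons_zero, Fin.cons_succ,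
    Fin.sum_univ_three, Finset.mul_sum, mul_assoc]
  simp

lemma tExp_mono {N : ℕ} {p : ℝ} (hp : 0 ≤ p) (hp' : 2 * p ≤ 1) {f g : (Fin N → ℝ) → ℝ}
    (h : ∀ s, f (signVec s) ≤ g (signVec s)) : tExp N p f ≤ tExp N p g := by
  refine Finset.sum_le_sum fun s _ => mul_le_mul_of_nonneg_left (h s) ?_
  refine Finset.prod_nonneg fun i _ => ?_
  generalize s i = a
  fin_cases a <;> simp <;> linarith

lemma tExp_const (N : ℕ) (p c : ℝ) : tExp N p (fun _ => c) = c := by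
  induction N with
  | zero => exact tExp_zero _ _
  | succ N ih => rw [tExp_succ, ih]; ring

lemma tExp_affine_sq (N : ℕ) (p a : ℝ) (u : Fin N → ℝ) :
    tExp N p (fun ε => (a + ε ⬝ᵥ u) ^ 2) = a ^ 2 + 2 * p * ∑ i, u i ^ 2 := by
  induction N generalizing a with
  | zero => simp [tExp_zero]
  | succ N ih =>
    have hc : ∀ (x : ℝ) (ε : Fin N → ℝ),
        a + (Fin.cons x ε : Fin (N + 1) → ℝ) ⬝ᵥ u
          = (a + x * u 0) + ε ⬝ᵥ (fun i => u i.succ) := by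
      intro x ε
      simp [dotProduct, Fin.sum_univ_succ, add_assoc]
    rw [tExp_succ]
    simp only [hc, ih, Fin.sum_univ_succ]
    ring

lemma tExp_dotProduct_sq (N : ℕ) (p : ℝ) (u : Fin N → ℝ) :
    tExp N p (fun ε => (ε ⬝ᵥ u) ^ 2) = 2 * p * ∑ i, u i ^ 2 := by
  simpa using tExp_affine_sq N p 0 u

/-- Jensen's inequality for the square root. -/
lemma tExp_sqrt_le {N : ℕ} {p : ℝ} (hp : 0 ≤ p) (hp' : 2 * p ≤ 1) {f : (Fin N → ℝ) → ℝ}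
    (hf : ∀ ε, 0 ≤ f ε) : tExp N p (fun ε => √(f ε)) ≤ √(tExp N p f) := by
  apply Real.le_sqrt_of_sq_le
  set m := tExp N p (fun ε => √(f ε)) with hm
  have h : tExp N p (fun ε => (-m ^ 2) + (2 * m) * √(f ε)) ≤ tExp N p f := by
    refine tExp_mono hp hp' fun s => ?_
    nlinarith [Real.sq_sqrt (hf (signVec s)), sq_nonneg (√(f (signVec s)) - m)]
  rw [tExp_add, tExp_const_mul, tExp_const, ← hm] at h
  linarith

lemma tExp_abs_dotProduct_le {N : ℕ} {p : ℝ} (hp : 0 ≤ p) (hp' : 2 * p ≤ 1) (u : Fin N → ℝ) :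
    tExp N p (fun ε => |ε ⬝ᵥ u|) ≤ √(2 * p * ∑ i, u i ^ 2) := by
  rw [← tExp_dotProduct_sq]
  simp only [← Real.sqrt_sq_eq_abs]
  exact tExp_sqrt_le hp hp' fun ε => sq_nonneg _

lemma LipschitzWith.iSup_add_add_iSup_sub_le {ι : Type*} [Finite ι] [Nonempty ι] {σ : ℝ → ℝ}
    (hσ : LipschitzWith 1 σ) (b x : ι → ℝ) :
    (⨆ i, (b i + σ (x i))) + (⨆ i, (b i - σ (x i))) ≤
      (⨆ i, (b i + x i)) + (⨆ i, (b i - x i)) := by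
  obtain ⟨i, hi⟩ := exists_eq_ciSup_of_finite (f := fun i => b i + σ (x i))
  obtain ⟨j, hj⟩ := exists_eq_ciSup_of_finite (f := fun i => b i - σ (x i))
  have hadd : ∀ k, b k + x k ≤ ⨆ i, (b i + x i) :=
    le_ciSup (f := fun i => b i + x i) (Set.finite_range _).bddAbove
  have hsub : ∀ k, b k - x k ≤ ⨆ i, (b i - x i) :=
    le_ciSup (f := fun i => b i - x i) (Set.finite_range _).bddAbove
  have hl : |σ (x i) - σ (x j)| ≤ |x i - x j| := by
    simpa [Real.dist_eq] using hσ.dist_le_mul (x i) (x j)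
  have h := (le_abs_self _).trans hl
  rw [← hi, ← hj]
  rcases abs_cases (x i - x j) with ⟨h', _⟩ | ⟨h', _⟩
  · linarith [hadd i, hsub j]
  · linarith [hadd j, hsub i]

/-- The contraction principle for transductive Rademacher averages over a finite family. -/
lemma tExp_iSup_contraction {ι : Type*} [Finite ι] [Nonempty ι] {N : ℕ} {p : ℝ}
    (hp : 0 ≤ p) (hp' : 2 * p ≤ 1) {σ : ℝ → ℝ} (hσ : LipschitzWith 1 σ)
    (a : ι → ℝ) (f : ι → Fin N → ℝ) :
    tExp N p (fun ε => ⨆ i, (a i + ε ⬝ᵥ (fun n => σ (f i n)))) ≤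
      tExp N p (fun ε => ⨆ i, (a i + ε ⬝ᵥ f i)) := by
  induction N generalizing a with
  | zero => simp [tExp_zero]
  | succ N ih =>
    have hc : ∀ (x : ℝ) (ε : Fin N → ℝ) (u : Fin (N + 1) → ℝ) (i : ι),
        a i + (Fin.cons x ε : Fin (N + 1) → ℝ) ⬝ᵥ u
          = (a i + x * u 0) + ε ⬝ᵥ (fun n => u n.succ) := by
      intro x ε u i
      simp [dotProduct, Fin.sum_univ_succ, add_assoc]
    simp only [tExp_succ, hc]
    have ih' := fun x : ℝ => ih (fun i => a i + x * σ (f i 0)) (fun i n => f i n.succ)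
    refine (add_le_add (add_le_add (mul_le_mul_of_nonneg_left (ih' 1) hp)
      (mul_le_mul_of_nonneg_left (ih' (-1)) hp))
      (mul_le_mul_of_nonneg_left (ih' 0) (by linarith : 0 ≤ 1 - 2 * p))).trans ?_
    simp only [zero_mul]
    gcongr ?_ + _
    rw [← mul_add, ← mul_add, ← tExp_add, ← tExp_add]
    refine mul_le_mul_of_nonneg_left (tExp_mono hp hp' fun s => ?_) hp
    have h := hσ.iSup_add_add_iSup_sub_le
      (fun i => a i + signVec s ⬝ᵥ (fun n => f i n.succ)) (fun i => f i 0)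
    convert h using 4 <;> ring

/-- `RadBound N p G C` says that `E_ε sup_{v ∈ G} |⟨ε, v⟩| ≤ C`, phrased through selections so
that no boundedness of `G` has to be tracked. -/
def RadBound (N : ℕ) (p : ℝ) (G : Set (Fin N → ℝ)) (C : ℝ) : Prop :=
  ∀ φ : (Fin N → ℝ) → Fin N → ℝ, (∀ ε, φ ε ∈ G) → tExp N p (fun ε => |ε ⬝ᵥ φ ε|) ≤ C

namespace RadBound

variable {N : ℕ} {p : ℝ} {G : Set (Fin N → ℝ)} {C : ℝ}

lemma mono (h : RadBound N p G C) {G' : Set (Fin N → ℝ)} (hG : G' ⊆ G) : RadBound N p G' C :=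
  fun φ hφ => h φ fun ε => hG (hφ ε)

lemma tExp_comp_le (hp : 0 ≤ p) (hp' : 2 * p ≤ 1) (h : RadBound N p G C) {σ : ℝ → ℝ}
    (hσ : LipschitzWith 1 σ) (φ : (Fin N → ℝ) → Fin N → ℝ) (hφ : ∀ ε, φ ε ∈ G) :
    tExp N p (fun ε => ε ⬝ᵥ (fun n => σ (φ ε n))) ≤ C := by
  have hmax : ∀ ε : Fin N → ℝ, ∃ s : Fin N → Fin 3,
      ε ⬝ᵥ φ (signVec s) = ⨆ s : Fin N → Fin 3, (0 + ε ⬝ᵥ φ (signVec s)) := by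
    intro ε
    simpa using exists_eq_ciSup_of_finite (f := fun s : Fin N → Fin 3 => ε ⬝ᵥ φ (signVec s))
  choose m hm using hmax
  calc tExp N p (fun ε => ε ⬝ᵥ (fun n => σ (φ ε n)))
      ≤ tExp N p (fun ε => ⨆ s : Fin N → Fin 3, (0 + ε ⬝ᵥ (fun n => σ (φ (signVec s) n)))) := by
        refine tExp_mono hp hp' fun s => ?_
        refine le_trans (zero_add _).ge
          (le_ciSup (f := fun t : Fin N → Fin 3 =>
            0 + signVec s ⬝ᵥ (fun n => σ (φ (signVec t) n))) (Set.finite_range _).bddAbove s)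
    _ ≤ tExp N p (fun ε => ⨆ s : Fin N → Fin 3, (0 + ε ⬝ᵥ φ (signVec s))) :=
        tExp_iSup_contraction hp hp' hσ (fun _ => 0) fun s : Fin N → Fin 3 => φ (signVec s)
    _ ≤ tExp N p (fun ε => |ε ⬝ᵥ φ (signVec (m ε))|) :=
        tExp_mono hp hp' fun s => (hm _).ge.trans (le_abs_self _)
    _ ≤ C := h _ fun ε => hφ _

lemma comp_lipschitz (hp : 0 ≤ p) (hp' : 2 * p ≤ 1) (h : RadBound N p G C) (hG : 0 ∈ G)
    {σ : ℝ → ℝ} (hσ : LipschitzWith 1 σ) (hσ0 : σ 0 = 0) :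
    RadBound N p ((fun v n => σ (v n)) '' G) (2 * C) := by
  classical
  have hpos : ∀ {τ : ℝ → ℝ}, LipschitzWith 1 τ → τ 0 = 0 →
      ∀ ψ : (Fin N → ℝ) → Fin N → ℝ, (∀ ε, ψ ε ∈ G) →
        tExp N p (fun ε => max (ε ⬝ᵥ (fun n => τ (ψ ε n))) 0) ≤ C := by
    intro τ hτ hτ0 ψ hψ
    refine le_trans (tExp_mono hp hp' fun s => ?_) (h.tExp_comp_le hp hp' hτ
      (fun ε => if 0 ≤ ε ⬝ᵥ (fun n => τ (ψ ε n)) then ψ ε else 0)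
      (fun ε => by split_ifs; exacts [hψ ε, hG]))
    by_cases hs : 0 ≤ signVec s ⬝ᵥ (fun n => τ (ψ (signVec s) n))
    · simp [hs]
    · simp only [hs, if_false]
      simpa [hτ0, dotProduct] using le_of_not_ge hs
  intro φ hφ
  choose ψ hψ hψφ using hφ
  have hneg : LipschitzWith 1 (fun t => -σ t) := hσ.neg
  calc tExp N p (fun ε => |ε ⬝ᵥ φ ε|)
      ≤ tExp N p (fun ε => max (ε ⬝ᵥ (fun n => σ (ψ ε n))) 0
          + max (ε ⬝ᵥ (fun n => -σ (ψ ε n))) 0) := by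
        refine tExp_mono hp hp' fun s => ?_
        have e : signVec s ⬝ᵥ (fun n => -σ (ψ (signVec s) n))
            = -(signVec s ⬝ᵥ (fun n => σ (ψ (signVec s) n))) := dotProduct_neg _ _
        rw [← hψφ, e]
        exact (max_zero_add_max_neg_zero_eq_abs_self _).ge
    _ ≤ 2 * C := by
        rw [tExp_add]
        linarith [hpos hσ hσ0 ψ hψ, hpos hneg (by simp [hσ0]) ψ hψ]

end RadBound

/-- Linear combinations of `h` elements of `G` whose coefficients have `ℓ1`-norm at most `b`. -/
def l1Hull {N : ℕ} (h : ℕ) (G : Set (Fin N → ℝ)) (b : ℝ) : Set (Fin N → ℝ) :=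
  {v | ∃ (w : Fin h → ℝ) (g : Fin h → Fin N → ℝ),
    (∀ r, g r ∈ G) ∧ ∑ r, |w r| ≤ b ∧ v = fun n => ∑ r, g r n * w r}

lemma zero_mem_l1Hull {N h : ℕ} {G : Set (Fin N → ℝ)} {b : ℝ} (hG : G.Nonempty) (hb : 0 ≤ b) :
    0 ∈ l1Hull h G b := by
  obtain ⟨g, hg⟩ := hG
  exact ⟨0, fun _ => g, fun _ => hg, by simpa using hb, by ext; simp⟩

lemma abs_sum_mul_le {h : ℕ} {w x : Fin h → ℝ} {b c : ℝ} (hc : 0 ≤ c) (hw : ∑ r, |w r| ≤ b)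
    (hx : ∀ r, |x r| ≤ c) : |∑ r, x r * w r| ≤ b * c := by
  calc |∑ r, x r * w r| ≤ ∑ r, |w r| * c := by
        refine (Finset.abs_sum_le_sum_abs _ _).trans (Finset.sum_le_sum fun r _ => ?_)
        rw [abs_mul, mul_comm]
        exact mul_le_mul_of_nonneg_left (hx r) (abs_nonneg _)
    _ ≤ b * c := by
        rw [← Finset.sum_mul]
        exact mul_le_mul_of_nonneg_right hw hc

lemma RadBound.hull {N : ℕ} {p : ℝ} {G : Set (Fin N → ℝ)} {C : ℝ} (hp : 0 ≤ p)
    (hp' : 2 * p ≤ 1) (hR : RadBound N p G C) {h : ℕ} (hh : 0 < h) {b : ℝ} (hb : 0 ≤ b) :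
    RadBound N p (l1Hull h G b) (b * C) := by
  have : Nonempty (Fin h) := ⟨⟨0, hh⟩⟩
  intro φ hφ
  choose w g hg hw hφg using hφ
  have hmax := fun ε : Fin N → ℝ => Finite.exists_max fun r => |ε ⬝ᵥ g ε r|
  choose m hm using hmax
  calc tExp N p (fun ε => |ε ⬝ᵥ φ ε|) ≤ tExp N p (fun ε => b * |ε ⬝ᵥ g ε (m ε)|) := by
        refine tExp_mono hp hp' fun s => ?_
        generalize signVec s = ε
        have e : ε ⬝ᵥ φ ε = ∑ r, (ε ⬝ᵥ g ε r) * w ε r := by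
          rw [hφg]
          simp only [dotProduct, Finset.mul_sum, Finset.sum_mul]
          rw [Finset.sum_comm]
          simp only [mul_assoc]
        rw [e]
        exact abs_sum_mul_le (abs_nonneg _) (hw ε) (hm ε)
    _ ≤ b * C := by
        rw [tExp_const_mul]
        exact mul_le_mul_of_nonneg_left (hR _ fun ε => hg ε _) hb

lemma radBound_columns {N q : ℕ} {p : ℝ} (hp : 0 ≤ p) (hp' : 2 * p ≤ 1)
    (X : Matrix (Fin N) (Fin q) ℝ) :
    RadBound N p (Set.range fun c n => X n c) (√(2 * p) * frob X) := by
  intro φ hφ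
  choose c hc using hφ
  calc tExp N p (fun ε => |ε ⬝ᵥ φ ε|)
      ≤ tExp N p (fun ε => √(∑ j, (ε ⬝ᵥ fun n => X n j) ^ 2)) := by
        refine tExp_mono hp hp' fun s => Real.abs_le_sqrt ?_
        rw [← hc]
        exact Finset.single_le_sum (f := fun j => (signVec s ⬝ᵥ fun n => X n j) ^ 2)
          (fun j _ => sq_nonneg _) (Finset.mem_univ _)
    _ ≤ √(tExp N p (fun ε => ∑ j, (ε ⬝ᵥ fun n => X n j) ^ 2)) :=
        tExp_sqrt_le hp hp' fun ε => Finset.sum_nonneg fun j _ => sq_nonneg _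
    _ = √(2 * p) * frob X := by
        rw [tExp_sum, frob, ← Real.sqrt_mul (by linarith)]
        simp only [tExp_dotProduct_sq]
        rw [← Finset.mul_sum, Finset.sum_comm]

/-- The columns that an MLP can output in layer `t` under the weight constraints `B`. -/
def mlpColumns {N q : ℕ} (h : ℕ) (σ : ℝ → ℝ) (X : Matrix (Fin N) (Fin q) ℝ) (B : ℕ → ℝ)
    (t : ℕ) : Set (Fin N → ℝ) :=
  {v | ∃ (W0 : Matrix (Fin q) (Fin h) ℝ) (Ws : ℕ → Matrix (Fin h) (Fin h) ℝ) (c : Fin h),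
    (∀ c, ∑ r, |W0 r c| ≤ B 0) ∧ (∀ l, l < t → ∀ c, ∑ r, |Ws l r c| ≤ B (l + 1)) ∧
    v = fun n => mlp σ X W0 Ws t n c}

lemma mlpColumns_nonempty {N q h : ℕ} (hh : 0 < h) (σ : ℝ → ℝ) (X : Matrix (Fin N) (Fin q) ℝ)
    {B : ℕ → ℝ} {t : ℕ} (hB : ∀ l ≤ t, 0 ≤ B l) : (mlpColumns h σ X B t).Nonempty :=
  ⟨_, 0, 0, ⟨0, hh⟩, fun _ => by simpa using hB 0 (Nat.zero_le _),
    fun l hl _ => by simpa using hB (l + 1) hl, rfl⟩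

lemma radBound_mlpColumns {N q h : ℕ} {p : ℝ} (hp : 0 ≤ p) (hp' : 2 * p ≤ 1) (hq : 0 < q)
    (hh : 0 < h) {σ : ℝ → ℝ} (hσ : LipschitzWith 1 σ) (hσ0 : σ 0 = 0)
    (X : Matrix (Fin N) (Fin q) ℝ) {B : ℕ → ℝ} {t : ℕ} (hB : ∀ l ≤ t, 0 ≤ B l) :
    RadBound N p (mlpColumns h σ X B t)
      (2 ^ (t + 1) * (∏ l ∈ Finset.range (t + 1), B l) * (√(2 * p) * frob X)) := by
  induction t with
  | zero =>
    have hcols : (Set.range fun c n => X n c).Nonempty := ⟨_, ⟨0, hq⟩, rfl⟩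
    have h := ((radBound_columns hp hp' X).hull hp hp' hq (hB 0 le_rfl)).comp_lipschitz hp hp'
      (zero_mem_l1Hull hcols (hB 0 le_rfl)) hσ hσ0
    convert h.mono ?_ using 1
    · simp; ring
    · rintro v ⟨W0, Ws, c, h0, -, rfl⟩
      exact ⟨_, ⟨fun r => W0 r c, fun r n => X n r, fun r => ⟨r, rfl⟩, h0 c, rfl⟩, rfl⟩
  | succ t ih =>
    have hBt : ∀ l ≤ t, 0 ≤ B l := fun l hl => hB l (hl.trans t.le_succ)
    have h := ((ih hBt).hull hp hp' hh (hB (t + 1) le_rfl)).comp_lipschitz hp hp'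
      (zero_mem_l1Hull (mlpColumns_nonempty hh σ X hBt) (hB (t + 1) le_rfl)) hσ hσ0
    convert h.mono ?_ using 1
    · rw [Finset.prod_range_succ, pow_succ]; ring
    · rintro v ⟨W0, Ws, c, h0, hs, rfl⟩
      exact ⟨_, ⟨fun r => Ws t r c, fun r n => mlp σ X W0 Ws t n r,
        fun r => ⟨W0, Ws, r, h0, fun l hl => hs l (hl.trans t.lt_succ_self), rfl⟩,
        hs t t.lt_succ_self c, rfl⟩, rfl⟩

lemma abs_mlp_le {N q h : ℕ} {σ : ℝ → ℝ} {R : ℝ} (hR : ∀ t, |σ t| ≤ R)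
    (X : Matrix (Fin N) (Fin q) ℝ) (W0 : Matrix (Fin q) (Fin h) ℝ)
    (Ws : ℕ → Matrix (Fin h) (Fin h) ℝ) (t : ℕ) (n : Fin N) (c : Fin h) :
    |mlp σ X W0 Ws t n c| ≤ R := by
  cases t <;> exact hR _

lemma sum_abs_mulVec_le {h : ℕ} {W : Matrix (Fin h) (Fin h) ℝ} {b : ℝ}
    (hW : ∀ c, ∑ r, |W r c| ≤ b) (v : Fin h → ℝ) :
    ∑ r, |(W *ᵥ v) r| ≤ b * ∑ r, |v r| := by
  calc ∑ r, |(W *ᵥ v) r| ≤ ∑ r, ∑ c, |W r c| * |v c| := by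
        refine Finset.sum_le_sum fun r _ => ?_
        simp only [← abs_mul]
        exact Finset.abs_sum_le_sum_abs (fun c => W r c * v c) Finset.univ
    _ = ∑ c, (∑ r, |W r c|) * |v c| := by
        rw [Finset.sum_comm]
        simp only [Finset.sum_mul]
    _ ≤ b * ∑ r, |v r| := by
        rw [Finset.mul_sum]
        exact Finset.sum_le_sum fun c _ => mul_le_mul_of_nonneg_right (hW c) (abs_nonneg _)

lemma sum_abs_pow_mulVec_le {h : ℕ} {W : Matrix (Fin h) (Fin h) ℝ} {b b' : ℝ} (hb : 0 ≤ b)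
    (hW : ∀ c, ∑ r, |W r c| ≤ b) {v : Fin h → ℝ} (hv : ∑ r, |v r| ≤ b') (k : ℕ) :
    ∑ r, |((W ^ k) *ᵥ v) r| ≤ b ^ k * b' := by
  induction k with
  | zero => simpa using hv
  | succ k ih =>
    rw [pow_succ', ← Matrix.mulVec_mulVec, pow_succ', mul_assoc]
    exact (sum_abs_mulVec_le hW _).trans (mul_le_mul_of_nonneg_left ih hb)

lemma Matrix.IsHermitian.pow_mulVec_eigenvectorBasis {N : ℕ} {A : Matrix (Fin N) (Fin N) ℝ}
    (hA : A.IsHermitian) (k : ℕ) (j : Fin N) :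
    (A ^ k) *ᵥ (hA.eigenvectorBasis j).ofLp =
      hA.eigenvalues j ^ k • (hA.eigenvectorBasis j).ofLp := by
  induction k with
  | zero => simp
  | succ k ih =>
    rw [pow_succ', ← Matrix.mulVec_mulVec, ih, Matrix.mulVec_smul, hA.mulVec_eigenvectorBasis,
      smul_smul, pow_succ]

lemma Matrix.IsHermitian.dotProduct_pow_mulVec {N : ℕ} {A : Matrix (Fin N) (Fin N) ℝ}
    (hA : A.IsHermitian) (k : ℕ) (x y : Fin N → ℝ) :
    x ⬝ᵥ ((A ^ k) *ᵥ y) = ∑ j, hA.eigenvalues j ^ k *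
      ((x ⬝ᵥ (hA.eigenvectorBasis j).ofLp) * ((hA.eigenvectorBasis j).ofLp ⬝ᵥ y)) := by
  have h := hA.eigenvectorBasis.sum_inner_mul_inner (WithLp.toLp 2 x) (WithLp.toLp 2 ((A ^ k) *ᵥ y))
  have hk : (A ^ k)ᵀ = A ^ k := by
    simpa using (hA.pow k).eq
  simp only [EuclideanSpace.inner_eq_star_dotProduct, star_trivial] at h
  rw [dotProduct_comm, ← h]
  refine Finset.sum_congr rfl fun j _ => ?_
  rw [dotProduct_comm ((A ^ k) *ᵥ y), Matrix.dotProduct_mulVec, ← Matrix.mulVec_transpose, hk,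
    hA.pow_mulVec_eigenvectorBasis, smul_dotProduct, smul_eq_mul, dotProduct_comm x]
  ring

lemma OrthonormalBasis.sum_sq_eq_one {N : ℕ}
    (b : OrthonormalBasis (Fin N) ℝ (EuclideanSpace ℝ (Fin N))) (j : Fin N) :
    ∑ i, (b j).ofLp i ^ 2 = 1 := by
  have h := EuclideanSpace.real_norm_sq_eq (b j)
  rw [b.norm_eq_one] at h
  simpa using h.symm

lemma abs_dotProduct_le_sqrt_mul {N : ℕ} {u x : Fin N → ℝ} {r : ℝ} (hr : 0 ≤ r)
    (hu : ∑ i, u i ^ 2 = 1) (hx : ∀ i, |x i| ≤ r) : |u ⬝ᵥ x| ≤ √N * r := by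
  have hx2 : ∑ i, x i ^ 2 ≤ N * r ^ 2 := by
    calc ∑ i, x i ^ 2 ≤ ∑ _i : Fin N, r ^ 2 :=
          Finset.sum_le_sum fun i _ => sq_le_sq' (abs_le.mp (hx i)).1 (abs_le.mp (hx i)).2
      _ = N * r ^ 2 := by simp
  have h := Finset.sum_mul_sq_le_sq_mul_sq Finset.univ u x
  rw [hu, one_mul] at h
  refine (Real.abs_le_sqrt (h.trans hx2)).trans_eq ?_
  rw [Real.sqrt_mul (Nat.cast_nonneg N), Real.sqrt_sq hr]

/-- A power of a symmetric matrix applied to uniformly bounded vectors. -/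
lemma radBound_pow_mulVec {N : ℕ} {p : ℝ} (hp : 0 ≤ p) (hp' : 2 * p ≤ 1)
    {A : Matrix (Fin N) (Fin N) ℝ} (hA : A.IsHermitian) (k : ℕ) {r : ℝ} (hr : 0 ≤ r) :
    RadBound N p ((fun x => (A ^ k) *ᵥ x) '' {x | ∀ i, |x i| ≤ r})
      ((∑ j, |hA.eigenvalues j| ^ k) * (√N * r)) := by
  intro φ hφ
  choose x hx hxφ using hφ
  calc tExp N p (fun ε => |ε ⬝ᵥ φ ε|)
      ≤ tExp N p (fun ε => ∑ j, (|hA.eigenvalues j| ^ k * (√N * r)) *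
          |ε ⬝ᵥ (hA.eigenvectorBasis j).ofLp|) := by
        refine tExp_mono hp hp' fun s => ?_
        rw [← hxφ, hA.dotProduct_pow_mulVec]
        refine (Finset.abs_sum_le_sum_abs _ _).trans (Finset.sum_le_sum fun j _ => ?_)
        rw [abs_mul, abs_mul, abs_pow, mul_assoc, mul_comm |_ ⬝ᵥ (hA.eigenvectorBasis j).ofLp|]
        gcongr
        exact abs_dotProduct_le_sqrt_mul hr (hA.eigenvectorBasis.sum_sq_eq_one j) (hx _)
    _ ≤ ∑ j, (|hA.eigenvalues j| ^ k * (√N * r)) * 1 := by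
        rw [tExp_sum]
        refine Finset.sum_le_sum fun j _ => ?_
        rw [tExp_const_mul]
        refine mul_le_mul_of_nonneg_left ?_ (by positivity)
        refine (tExp_abs_dotProduct_le hp hp' _).trans ?_
        rw [hA.eigenvectorBasis.sum_sq_eq_one j, mul_one]
        exact Real.sqrt_le_one.mpr hp'
    _ = (∑ j, |hA.eigenvalues j| ^ k) * (√N * r) := by
        simp only [mul_one, Finset.sum_mul]

lemma tExp_sSup_le {N : ℕ} {p : ℝ} (hp : 0 ≤ p) (hp' : 2 * p ≤ 1) {S : (Fin N → ℝ) → Set ℝ}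
    (hS : ∀ ε, (S ε).Nonempty) {K : ℝ}
    (h : ∀ y : (Fin N → ℝ) → ℝ, (∀ ε, y ε ∈ S ε) → tExp N p y ≤ K) :
    tExp N p (fun ε => sSup (S ε)) ≤ K := by
  refine le_of_forall_pos_le_add fun δ hδ => ?_
  choose y hy hlt using fun ε => exists_lt_of_lt_csSup (hS ε) (sub_lt_self (sSup (S ε)) hδ)
  calc tExp N p (fun ε => sSup (S ε)) ≤ tExp N p (fun ε => y ε + δ) :=
        tExp_mono hp hp' fun s => by linarith [hlt (signVec s)]
    _ ≤ K + δ := by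
        rw [tExp_add, tExp_const]
        exact add_le_add_left (h y hy) δ

lemma abs_dotProduct_agpcn_le {N h : ℕ} (L : ℕ) (A : Matrix (Fin N) (Fin N) ℝ)
    (Y : Matrix (Fin N) (Fin h) ℝ) (W : Matrix (Fin h) (Fin h) ℝ) (w : Fin h → ℝ) {θ : ℕ → ℝ}
    (hθ : ∀ k ≤ L, 0 ≤ θ k) (ε : Fin N → ℝ) :
    |∑ n, ε n * ((θ 0 • Y + ∑ k ∈ Finset.Icc 1 L, θ k • (A ^ k * Y * W ^ k)).mulVec w) n| ≤
      θ 0 * |ε ⬝ᵥ (Y *ᵥ w)|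
        + ∑ k ∈ Finset.Icc 1 L, θ k * |ε ⬝ᵥ ((A ^ k) *ᵥ (Y *ᵥ ((W ^ k) *ᵥ w)))| := by
  change |ε ⬝ᵥ _| ≤ _
  rw [Matrix.add_mulVec, Matrix.smul_mulVec, Matrix.sum_mulVec, dotProduct_add, dotProduct_smul,
    dotProduct_sum, smul_eq_mul]
  refine (abs_add_le _ _).trans (add_le_add ?_ ?_)
  · rw [abs_mul, abs_of_nonneg (hθ 0 L.zero_le)]
  · refine (Finset.abs_sum_le_sum_abs _ _).trans_eq (Finset.sum_congr rfl fun k hk => ?_)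
    rw [Matrix.smul_mulVec, dotProduct_smul, smul_eq_mul, abs_mul,
      abs_of_nonneg (hθ k (Finset.mem_Icc.mp hk).2)]
    simp only [Matrix.mulVec_mulVec, Matrix.mul_assoc]

/-- Rademacher complexity bound for the AGPCN model (Theorem 2 with μ = 1). -/
theorem agpcn_rademacher_bound :
    ∃ C' : ℝ, 0 < C' ∧
      ∀ (N q h T L M U : ℕ), 0 < N → 0 < q → 0 < h → 0 < T → 0 < L → 0 < M → 0 < U →
      ∀ (X : Matrix (Fin N) (Fin q) ℝ) (A : Matrix (Fin N) (Fin N) ℝ)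
        (hA : A.IsHermitian) (σ : ℝ → ℝ) (R : ℝ),
        LipschitzWith 1 σ → σ 0 = 0 → (∀ t, |σ t| ≤ R) →
      ∀ (B : ℕ → ℝ) (θ : ℕ → ℝ),
        (∀ l ≤ T + 1, 0 ≤ B l) → (∀ k ≤ L, 0 ≤ θ k) →
      tExp N ((M : ℝ) * U / ((M : ℝ) + U) ^ 2) (fun ε =>
        sSup {y : ℝ | ∃ (W0 : Matrix (Fin q) (Fin h) ℝ)
            (Ws : ℕ → Matrix (Fin h) (Fin h) ℝ)
            (WT : Matrix (Fin h) (Fin h) ℝ)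
            (w : Fin h → ℝ),
          (∀ c, ∑ r, |W0 r c| ≤ B 0) ∧
          (∀ l, l < T - 1 → ∀ c, ∑ r, |Ws l r c| ≤ B (l + 1)) ∧
          (∀ c, ∑ r, |WT r c| ≤ B T) ∧
          (∑ r, |w r| ≤ B (T + 1)) ∧
          y = |∑ n, ε n *
            ((θ 0 • mlp σ X W0 Ws (T - 1)
                + (∑ k ∈ Finset.Icc 1 L,
                    θ k • (A ^ k * mlp σ X W0 Ws (T - 1) * WT ^ k))).mulVec w) n|})
      ≤ C' * B (T + 1) *
          ((2 : ℝ) ^ T * (∏ l ∈ Finset.range T, B l) *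
              Real.sqrt (2 * (M : ℝ) * U / ((M : ℝ) + U) ^ 2) *
              (θ 0 + (∑ k ∈ Finset.Icc 1 L,
                      (B T) ^ k * θ k * ∑ j, |hA.eigenvalues j| ^ k)) * frob X
            + (∑ k ∈ Finset.Icc 1 L,
                    (B T) ^ k * θ k * ∑ j, |hA.eigenvalues j| ^ k) *
                Real.sqrt (N : ℝ) * R) := by
  refine ⟨1, one_pos, ?_⟩
  intro N q h T L M U _ hq hh hT _ hM _ X A hA σ R hσ hσ0 hR B θ hB hθ
  obtain ⟨t, rfl⟩ : ∃ t, T = t + 1 := ⟨T - 1, by omega⟩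
  simp only [Nat.add_sub_cancel]
  set p : ℝ := (M : ℝ) * U / ((M : ℝ) + U) ^ 2 with hpdef
  have hM0 : (0 : ℝ) < M := by exact_mod_cast hM
  have hp : 0 ≤ p := by positivity
  have hp' : 2 * p ≤ 1 := by
    rw [hpdef, ← mul_div_assoc, div_le_one (by positivity)]
    nlinarith [sq_nonneg (M : ℝ), sq_nonneg (U : ℝ)]
  have hsqrt : 2 * (M : ℝ) * U / ((M : ℝ) + U) ^ 2 = 2 * p := by
    rw [hpdef]; ring
  rw [hsqrt]
  have hR0 : 0 ≤ R := (abs_nonneg _).trans (hR 0)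
  have hBt : ∀ l ≤ t, 0 ≤ B l := fun l hl => hB l (by omega)
  have hBT : 0 ≤ B (t + 1) := hB _ (by omega)
  have hBT' : 0 ≤ B (t + 1 + 1) := hB _ le_rfl
  refine tExp_sSup_le hp hp' (fun ε => ?_) ?_
  · exact ⟨_, 0, 0, 0, 0, fun _ => by simpa using hBt 0 t.zero_le,
      fun l hl _ => by simpa using hBt (l + 1) hl, fun _ => by simpa using hBT,
      by simpa using hBT', rfl⟩
  intro y hy
  choose W0 Ws WT w h0 hs hWT hw hy using hy
  have hfirst := (radBound_mlpColumns hp hp' hq hh hσ hσ0 X hBt).hull hp hp' hh hBT'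
    (fun ε => mlp σ X (W0 ε) (Ws ε) t *ᵥ w ε)
    (fun ε => ⟨w ε, fun r n => mlp σ X (W0 ε) (Ws ε) t n r,
      fun r => ⟨W0 ε, Ws ε, r, h0 ε, hs ε, rfl⟩, hw ε, rfl⟩)
  have hpow := fun k => radBound_pow_mulVec hp hp' hA k
    (r := B (t + 1) ^ k * B (t + 1 + 1) * R) (by positivity)
    (fun ε => (A ^ k) *ᵥ (mlp σ X (W0 ε) (Ws ε) t *ᵥ ((WT ε ^ k) *ᵥ w ε)))
    (fun ε => ⟨_, fun n => abs_sum_mul_le hR0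
      (sum_abs_pow_mulVec_le hBT (hWT ε) (hw ε) k) (abs_mlp_le hR X _ _ t n), rfl⟩)
  set P := ∏ l ∈ Finset.range (t + 1), B l with hP
  have hP0 : 0 ≤ P := Finset.prod_nonneg fun l hl =>
    hBt l (Nat.lt_succ_iff.mp (Finset.mem_range.mp hl))
  set E := ∑ k ∈ Finset.Icc 1 L, B (t + 1) ^ k * θ k * ∑ j, |hA.eigenvalues j| ^ k with hE
  have hE0 : 0 ≤ E := Finset.sum_nonneg fun k hk =>
    mul_nonneg (mul_nonneg (by positivity) (hθ k (Finset.mem_Icc.mp hk).2))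
      (Finset.sum_nonneg fun j _ => by positivity)
  have hX0 : 0 ≤ frob X := Real.sqrt_nonneg _
  calc tExp N p y
      ≤ tExp N p (fun ε => θ 0 * |ε ⬝ᵥ (mlp σ X (W0 ε) (Ws ε) t *ᵥ w ε)|
          + ∑ k ∈ Finset.Icc 1 L, θ k *
            |ε ⬝ᵥ ((A ^ k) *ᵥ (mlp σ X (W0 ε) (Ws ε) t *ᵥ ((WT ε ^ k) *ᵥ w ε)))|) := by
        refine tExp_mono hp hp' fun s => ?_
        rw [hy]
        exact abs_dotProduct_agpcn_le L A _ _ _ hθ _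
    _ ≤ θ 0 * (B (t + 1 + 1) * (2 ^ (t + 1) * P * (√(2 * p) * frob X)))
          + ∑ k ∈ Finset.Icc 1 L, θ k * ((∑ j, |hA.eigenvalues j| ^ k) *
            (√N * (B (t + 1) ^ k * B (t + 1 + 1) * R))) := by
        rw [tExp_add, tExp_const_mul, tExp_sum]
        refine add_le_add (mul_le_mul_of_nonneg_left hfirst (hθ 0 L.zero_le))
          (Finset.sum_le_sum fun k hk => ?_)
        rw [tExp_const_mul]
        exact mul_le_mul_of_nonneg_left (hpow k) (hθ k (Finset.mem_Icc.mp hk).2)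
    _ = 1 * B (t + 1 + 1) * (2 ^ (t + 1) * P * √(2 * p) * θ 0 * frob X + E * √N * R) := by
        rw [mul_add, hE, Finset.sum_mul, Finset.sum_mul, Finset.mul_sum]
        congr 1
        · ring
        · exact Finset.sum_congr rfl fun k _ => by ring
    _ ≤ _ := by
        gcongr
        linarith
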